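/- Linked cluster theorem for forms: δ-convolution exponential and δ-convolution logarithm are mutually inverse. For every unital form ρ on H one has e^{∗̂(log^{∗̂}ρ)} = ρ, i.e. ρ = e^{∗̂ ρ_c} where ρ_c := log^{∗̂}ρ is the connected form of ρ; and for every infinitesimal form s one has log^{∗̂}(e^{∗̂ s}) = s. -/

import Mathlib

/-! Statement 12: linked cluster theorem: δ-convolution exp and log are mutually inverse. -/

open MvPolynomial TensorProduct
open scoped Classical

noncomputable section

abbrev H (σ : Type) := MvPolynomial σ ℚ

/-- The counit `ε`: the constant-coefficient map (evaluation of all variables at `0`). -/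
def counitF (σ : Type) : H σ →ₗ[ℚ] ℚ :=
  (aeval (R := ℚ) fun _ : σ => (0 : ℚ)).toLinearMap

/-- The disconnecting coproduct `δ`, defined on the monomial basis by
`δ(∏_{x ∈ supp d} (X x)^{d x}) =
   Σ_{S ⊆ supp d} (∏_{x ∈ S} (X x)^{d x}) ⊗ (∏_{x ∉ S} (X x)^{d x})`:
each full power `(X x)^{d x}` is a single primitive block. -/
def deltaD (σ : Type) : H σ →ₗ[ℚ] (H σ) ⊗[ℚ] (H σ) :=
  (basisMonomials σ ℚ).constr ℚ fun d =>
    ∑ S ∈ d.support.powerset,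
      (monomial (d.filter fun a => a ∈ S) (1 : ℚ)) ⊗ₜ[ℚ]
        (monomial (d.filter fun a => a ∉ S) (1 : ℚ))

/-- A form is a ℚ-linear map `H → ℚ`. -/
abbrev Form (σ : Type) := MvPolynomial σ ℚ →ₗ[ℚ] ℚ

/-- The δ-convolution of forms: `(ρ ∗̂ τ)(u) = Σ ρ(u⁽¹⁾) τ(u⁽²⁾)` where
`δu = Σ u⁽¹⁾ ⊗ u⁽²⁾`. -/
def convD {σ : Type} (ρ τ : Form σ) : Form σ :=
  (TensorProduct.lid ℚ ℚ).toLinearMap ∘ₗ (TensorProduct.map ρ τ) ∘ₗ deltaD σ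

/-- δ-convolution powers: `ρ^{∗̂0} = ε`, `ρ^{∗̂(n+1)} = ρ^{∗̂n} ∗̂ ρ`. -/
def convPowD {σ : Type} (ρ : Form σ) : ℕ → Form σ
  | 0 => counitF σ
  | n + 1 => convD (convPowD ρ n) ρ

/-- The δ-convolution exponential `e^{∗̂s} : u ↦ Σ_{n≥0} s^{∗̂n}(u)/n!`.  On each
`u` the sum is finite since `s^{∗̂n}` vanishes on any monomial with fewer than
`n` distinct variables; it is the linear form whose value on the basis monomial
`X^d` (with `d.support.card` distinct variables) is the corresponding finite sum. -/
def convExpD {σ : Type} (s : Form σ) : Form σ :=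
  (basisMonomials σ ℚ).constr ℚ fun d =>
    ∑ n ∈ Finset.range (d.support.card + 1),
      ((n.factorial : ℚ))⁻¹ * convPowD s n (monomial d 1)

/-- The δ-convolution logarithm
`log^{∗̂}ρ : u ↦ Σ_{n≥1} ((-1)^{n+1}/n)·(ρ-ε)^{∗̂n}(u)`, likewise a finite sum. -/
def convLogD {σ : Type} (ρ : Form σ) : Form σ :=
  (basisMonomials σ ℚ).constr ℚ fun d =>
    ∑ n ∈ Finset.Icc 1 d.support.card,
      (((-1 : ℚ)) ^ (n + 1) / n) * convPowD (ρ - counitF σ) n (monomial d 1)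

section LinkedCluster

variable {σ : Type}

lemma form_ext {f g : Form σ} (h : ∀ d, f (monomial d 1) = g (monomial d 1)) : f = g :=
  (basisMonomials σ ℚ).ext fun d => by simpa using h d

lemma constr_basisMonomials_monomial {M : Type*} [AddCommMonoid M] [Module ℚ M]
    (F : (σ →₀ ℕ) → M) (d : σ →₀ ℕ) :
    (basisMonomials σ ℚ).constr ℚ F (monomial d 1) = F d := by
  simpa using (basisMonomials σ ℚ).constr_basis ℚ F d

lemma counitF_monomial (d : σ →₀ ℕ) :
    counitF σ (monomial d 1) = if d = 0 then 1 else 0 := by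
  rw [counitF, AlgHom.toLinearMap_apply, ← constantCoeff_monomial, constantCoeff_eq,
    aeval_zero']
  simp [constantCoeff_eq]

/-- The pairs of exponents with disjoint supports summing to `d`. -/
def disjointSplits (d : σ →₀ ℕ) : Finset ((σ →₀ ℕ) × (σ →₀ ℕ)) :=
  {p ∈ Finset.HasAntidiagonal.antidiagonal d | Disjoint p.1.support p.2.support}

lemma mem_disjointSplits {d : σ →₀ ℕ} {p : (σ →₀ ℕ) × (σ →₀ ℕ)} :
    p ∈ disjointSplits d ↔ p.1 + p.2 = d ∧ Disjoint p.1.support p.2.support := by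
  simp [disjointSplits]

lemma card_add_card_of_mem_disjointSplits {d : σ →₀ ℕ} {p : (σ →₀ ℕ) × (σ →₀ ℕ)}
    (hp : p ∈ disjointSplits d) :
    p.1.support.card + p.2.support.card = d.support.card := by
  obtain ⟨rfl, h⟩ := mem_disjointSplits.1 hp
  rw [Finsupp.support_add_eq h, Finset.card_union_of_disjoint h]

lemma convD_monomial (f g : Form σ) (d : σ →₀ ℕ) :
    convD f g (monomial d 1) =
      ∑ p ∈ disjointSplits d, f (monomial p.1 1) * g (monomial p.2 1) := by
  simp only [convD, deltaD, LinearMap.comp_apply, constr_basisMonomials_monomial, map_sum,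
    TensorProduct.map_tmul, LinearEquiv.coe_coe, TensorProduct.lid_tmul, smul_eq_mul]
  refine Finset.sum_bij' (fun S _ => (d.filter fun a => a ∈ S, d.filter fun a => a ∉ S))
    (fun p _ => p.1.support) ?_ ?_ ?_ ?_ ?_
  · intro S _
    refine mem_disjointSplits.2 ⟨Finsupp.filter_add_filter_not d fun a => a ∈ S, ?_⟩
    rw [Finsupp.support_filter, Finsupp.support_filter]
    exact Finset.disjoint_filter_filter_not _ _ _
  · intro p hp
    obtain ⟨rfl, -⟩ := mem_disjointSplits.1 hp
    rw [Finset.mem_powerset, Finsupp.support_add_eq_union]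
    exact Finset.subset_union_left
  · intro S hS
    ext a
    have : a ∈ S → a ∈ d.support := fun ha => Finset.mem_powerset.1 hS ha
    simp only [Finsupp.support_filter, Finset.mem_filter]
    tauto
  · intro p hp
    obtain ⟨rfl, h⟩ := mem_disjointSplits.1 hp
    have h' : ∀ a, p.1 a = 0 ∨ p.2 a = 0 := fun a => by
      by_contra! hc
      exact Finset.disjoint_left.1 h (Finsupp.mem_support_iff.2 hc.1)
        (Finsupp.mem_support_iff.2 hc.2)
    refine Prod.ext (Finsupp.ext fun a => ?_) (Finsupp.ext fun a => ?_) <;>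
    · have := h' a
      simp only [Finsupp.filter_apply, Finsupp.mem_support_iff, Finsupp.add_apply]
      split_ifs <;> omega
  · intro S _
    rfl

lemma convD_comm (f g : Form σ) : convD f g = convD g f := by
  refine form_ext fun d => ?_
  rw [convD_monomial, convD_monomial]
  refine Finset.sum_nbij' Prod.swap Prod.swap ?_ ?_ (fun _ _ => rfl) (fun _ _ => rfl)
    (fun _ _ => mul_comm _ _) <;>
  · intro p hp
    obtain ⟨rfl, h⟩ := mem_disjointSplits.1 hp
    exact mem_disjointSplits.2 ⟨add_comm _ _, h.symm⟩

lemma convD_assoc (f g h : Form σ) : convD (convD f g) h = convD f (convD g h) := by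
  refine form_ext fun d => ?_
  simp only [convD_monomial, Finset.sum_mul, Finset.mul_sum, Finset.sum_sigma']
  refine Finset.sum_nbij' (fun ⟨⟨_, j⟩, ⟨k, l⟩⟩ => ⟨(k, l + j), (l, j)⟩)
    (fun ⟨⟨i, _⟩, ⟨k, l⟩⟩ => ⟨(i + k, l), (i, k)⟩) ?_ ?_ ?_ ?_ ?_
  · rintro ⟨⟨i, j⟩, ⟨k, l⟩⟩ hp
    simp only [Finset.mem_sigma, mem_disjointSplits] at hp ⊢
    obtain ⟨⟨rfl, hd⟩, rfl, hd'⟩ := hp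
    simp only [Finsupp.support_add_eq_union, Finset.disjoint_union_left,
      Finset.disjoint_union_right] at hd ⊢
    exact ⟨⟨(add_assoc _ _ _).symm, hd', hd.1⟩, trivial, hd.2⟩
  · rintro ⟨⟨i, j⟩, ⟨k, l⟩⟩ hp
    simp only [Finset.mem_sigma, mem_disjointSplits] at hp ⊢
    obtain ⟨⟨rfl, hd⟩, rfl, hd'⟩ := hp
    simp only [Finsupp.support_add_eq_union, Finset.disjoint_union_left,
      Finset.disjoint_union_right] at hd ⊢
    exact ⟨⟨add_assoc _ _ _, hd.2, hd'⟩, trivial, hd.1⟩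
  · rintro ⟨⟨i, j⟩, ⟨k, l⟩⟩ hp
    simp only [Finset.mem_sigma, mem_disjointSplits] at hp
    obtain ⟨⟨rfl, -⟩, rfl, -⟩ := hp
    rfl
  · rintro ⟨⟨i, j⟩, ⟨k, l⟩⟩ hp
    simp only [Finset.mem_sigma, mem_disjointSplits] at hp
    obtain ⟨⟨rfl, -⟩, rfl, -⟩ := hp
    rfl
  · intro _ _
    exact mul_assoc _ _ _

/-- The δ-convolution as a bilinear map. -/
def convBilin (σ : Type) : Form σ →ₗ[ℚ] Form σ →ₗ[ℚ] Form σ :=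
  LinearMap.mk₂ ℚ convD
    (fun _ _ _ => form_ext fun d => by
      simp [convD_monomial, add_mul, Finset.sum_add_distrib])
    (fun _ _ _ => form_ext fun d => by simp [convD_monomial, Finset.mul_sum, mul_assoc])
    (fun _ _ _ => form_ext fun d => by
      simp [convD_monomial, mul_add, Finset.sum_add_distrib])
    (fun _ _ _ => form_ext fun d => by
      simp [convD_monomial, Finset.mul_sum, mul_left_comm])

lemma convD_add_left (f g h : Form σ) : convD (f + g) h = convD f h + convD g h :=
  LinearMap.map_add₂ (convBilin σ) f g h

lemma convD_add_right (f g h : Form σ) : convD f (g + h) = convD f g + convD f h :=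
  map_add (convBilin σ f) g h

lemma convD_sub_left (f g h : Form σ) : convD (f - g) h = convD f h - convD g h :=
  LinearMap.map_sub₂ (convBilin σ) f g h

lemma convD_sub_right (f g h : Form σ) : convD f (g - h) = convD f g - convD f h :=
  map_sub (convBilin σ f) g h

lemma convD_smul_left (c : ℚ) (f g : Form σ) : convD (c • f) g = c • convD f g :=
  LinearMap.map_smul₂ (convBilin σ) c f g

lemma convD_smul_right (c : ℚ) (f g : Form σ) : convD f (c • g) = c • convD f g :=
  map_smul (convBilin σ f) c g

lemma convD_zero_left (f : Form σ) : convD 0 f = 0 :=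
  LinearMap.map_zero₂ (convBilin σ) f

lemma convD_zero_right (f : Form σ) : convD f 0 = 0 :=
  map_zero (convBilin σ f)

lemma convD_counitF (f : Form σ) : convD f (counitF σ) = f := by
  refine form_ext fun d => ?_
  rw [convD_monomial, Finset.sum_eq_single (d, 0)]
  · rw [counitF_monomial, if_pos rfl, mul_one]
  · rintro ⟨a, b⟩ hp hne
    obtain ⟨rfl, -⟩ := mem_disjointSplits.1 hp
    rw [counitF_monomial, if_neg, mul_zero]
    rintro rfl
    simp at hne
  · exact fun h => absurd (mem_disjointSplits.2 (by simp)) h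

lemma counitF_convD (f : Form σ) : convD (counitF σ) f = f := by
  rw [convD_comm, convD_counitF]

lemma form_apply_one (f : Form σ) : f 1 = f (monomial 0 1) := rfl

lemma sub_counitF_apply_one {ρ : Form σ} (hρ : ρ 1 = 1) : (ρ - counitF σ) 1 = 0 := by
  rw [LinearMap.sub_apply, hρ, form_apply_one (counitF σ), counitF_monomial, if_pos rfl,
    sub_self]

lemma convPowD_monomial_eq_zero {s : Form σ} (hs : s 1 = 0) (n : ℕ) (d : σ →₀ ℕ)
    (hd : d.support.card < n) : convPowD s n (monomial d 1) = 0 := by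
  induction n generalizing d with
  | zero => omega
  | succ n ih =>
    rw [convPowD, convD_monomial]
    refine Finset.sum_eq_zero fun p hp => ?_
    have hcard := card_add_card_of_mem_disjointSplits hp
    by_cases h : p.1.support.card < n
    · rw [ih _ h, zero_mul]
    · have h0 : p.2 = 0 := Finsupp.card_support_eq_zero.1 (by omega)
      rw [h0, ← form_apply_one, hs, mul_zero]

/-- The operator multiplying the value at a monomial by its number of distinct variables;
it is a derivation for the δ-convolution. -/
def cardDeriv (σ : Type) : Form σ →ₗ[ℚ] Form σ where
  toFun f := (basisMonomials σ ℚ).constr ℚ fun d => (d.support.card : ℚ) * f (monomial d 1)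
  map_add' f g := form_ext fun d => by
    simp only [constr_basisMonomials_monomial, LinearMap.add_apply, mul_add]
  map_smul' c f := form_ext fun d => by
    simp only [constr_basisMonomials_monomial, LinearMap.smul_apply, smul_eq_mul,
      RingHom.id_apply, mul_left_comm]

lemma cardDeriv_monomial (f : Form σ) (d : σ →₀ ℕ) :
    cardDeriv σ f (monomial d 1) = d.support.card * f (monomial d 1) :=
  constr_basisMonomials_monomial _ d

lemma cardDeriv_apply_one (f : Form σ) : cardDeriv σ f 1 = 0 := by
  rw [form_apply_one, cardDeriv_monomial]
  simp

lemma cardDeriv_convD (f g : Form σ) :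
    cardDeriv σ (convD f g) = convD (cardDeriv σ f) g + convD f (cardDeriv σ g) := by
  refine form_ext fun d => ?_
  simp only [cardDeriv_monomial, LinearMap.add_apply, convD_monomial, Finset.mul_sum,
    ← Finset.sum_add_distrib]
  refine Finset.sum_congr rfl fun p hp => ?_
  rw [← card_add_card_of_mem_disjointSplits hp]
  push_cast
  ring

lemma cardDeriv_counitF : cardDeriv σ (counitF σ) = 0 := by
  refine form_ext fun d => ?_
  rw [cardDeriv_monomial, counitF_monomial]
  split_ifs with h <;> simp [h]

lemma eq_zero_of_cardDeriv_eq_zero {f : Form σ} (h1 : f 1 = 0) (h : cardDeriv σ f = 0) :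
    f = 0 := by
  refine form_ext fun d => ?_
  rcases eq_or_ne d 0 with rfl | hd
  · exact h1
  · have := cardDeriv_monomial f d
    rw [h, LinearMap.zero_apply, zero_eq_mul, Nat.cast_eq_zero,
      Finsupp.card_support_eq_zero] at this
    exact this.resolve_left hd

lemma cardDeriv_convPowD_succ (f : Form σ) (n : ℕ) :
    cardDeriv σ (convPowD f (n + 1)) =
      ((n : ℚ) + 1) • convD (convPowD f n) (cardDeriv σ f) := by
  induction n with
  | zero => simp [convPowD, counitF_convD]
  | succ n ih =>
    rw [convPowD, cardDeriv_convD, ih, convD_smul_left, convD_assoc,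
      convD_comm (cardDeriv σ f) f, ← convD_assoc, ← convPowD]
    push_cast
    module

lemma eq_zero_of_cardDeriv_eq_convD {f g : Form σ} (hf : f 1 = 0) (hg : g 1 = 0)
    (h : cardDeriv σ f = convD f g) : f = 0 := by
  suffices ∀ n, ∀ d : σ →₀ ℕ, d.support.card = n → f (monomial d 1) = 0 from
    form_ext fun d => this _ d rfl
  intro n
  induction n using Nat.strong_induction_on with
  | _ n ih =>
    intro d hd
    rcases eq_or_ne d 0 with rfl | hd0
    · exact hf
    have hzero : convD f g (monomial d 1) = 0 := by
      rw [convD_monomial]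
      refine Finset.sum_eq_zero fun p hp => ?_
      have hcard := card_add_card_of_mem_disjointSplits hp
      rcases eq_or_ne p.2 0 with h0 | h0
      · rw [h0, ← form_apply_one, hg, mul_zero]
      · have := mt Finsupp.card_support_eq_zero.1 h0
        rw [ih p.1.support.card (by omega) p.1 rfl, zero_mul]
    rw [← h, cardDeriv_monomial, mul_eq_zero, Nat.cast_eq_zero,
      Finsupp.card_support_eq_zero] at hzero
    exact hzero.resolve_left hd0

lemma eq_zero_of_convD_eq_zero {f g : Form σ} (hf : f 1 = 1) (h : convD f g = 0) :
    g = 0 := by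
  suffices ∀ n, ∀ d : σ →₀ ℕ, d.support.card = n → g (monomial d 1) = 0 from
    form_ext fun d => this _ d rfl
  intro n
  induction n using Nat.strong_induction_on with
  | _ n ih =>
    intro d hd
    have hd' : convD f g (monomial d 1) = g (monomial d 1) := by
      rw [convD_monomial, Finset.sum_eq_single (0, d)]
      · rw [← form_apply_one, hf, one_mul]
      · rintro ⟨a, b⟩ hp hne
        have hcard := card_add_card_of_mem_disjointSplits hp
        obtain ⟨hab, -⟩ := mem_disjointSplits.1 hp
        have ha : a ≠ 0 := by
          rintro rfl
          exact hne (Prod.ext rfl (by simpa using hab))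
        have := mt Finsupp.card_support_eq_zero.1 ha
        rw [ih b.support.card (by dsimp only at hcard; omega) b rfl, mul_zero]
      · exact fun h => absurd (mem_disjointSplits.2 (by simp)) h
    rw [← hd', h, LinearMap.zero_apply]

lemma convD_monomial_congr_left {f f' g : Form σ} {d : σ →₀ ℕ}
    (h : ∀ a : σ →₀ ℕ, a.support.card ≤ d.support.card →
      f (monomial a 1) = f' (monomial a 1)) :
    convD f g (monomial d 1) = convD f' g (monomial d 1) := by
  rw [convD_monomial, convD_monomial]
  refine Finset.sum_congr rfl fun p hp => ?_
  rw [h _ ((Nat.le_add_right _ _).trans_eq (card_add_card_of_mem_disjointSplits hp))]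

lemma convD_monomial_congr_right {f g g' : Form σ} {d : σ →₀ ℕ}
    (h : ∀ a : σ →₀ ℕ, a.support.card ≤ d.support.card →
      g (monomial a 1) = g' (monomial a 1)) :
    convD f g (monomial d 1) = convD f g' (monomial d 1) := by
  rw [convD_comm f g, convD_comm f g', convD_monomial_congr_left h]

/-- The partial sums of the δ-convolution exponential series. -/
def convExpTrunc (s : Form σ) (N : ℕ) : Form σ :=
  ∑ n ∈ Finset.range N, (n.factorial : ℚ)⁻¹ • convPowD s n

/-- The partial sums of the δ-convolution series of `log (1 + u)`. -/
def convLogTrunc (u : Form σ) (N : ℕ) : Form σ :=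
  ∑ n ∈ Finset.range N, ((-1 : ℚ) ^ n / (n + 1)) • convPowD u (n + 1)

lemma convExpD_monomial {s : Form σ} (hs : s 1 = 0) {d : σ →₀ ℕ} {N : ℕ}
    (hN : d.support.card < N) :
    convExpD s (monomial d 1) = convExpTrunc s N (monomial d 1) := by
  rw [convExpD, constr_basisMonomials_monomial, convExpTrunc, LinearMap.sum_apply]
  refine Finset.sum_subset (Finset.range_subset_range.2 hN) fun n _ hn => ?_
  rw [convPowD_monomial_eq_zero hs n d (by simpa using hn), mul_zero]

lemma convLogD_monomial {ρ : Form σ} (hρ : ρ 1 = 1) {d : σ →₀ ℕ} {N : ℕ}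
    (hN : d.support.card ≤ N) :
    convLogD ρ (monomial d 1) = convLogTrunc (ρ - counitF σ) N (monomial d 1) := by
  have hu := sub_counitF_apply_one hρ
  rw [convLogD, constr_basisMonomials_monomial, convLogTrunc, LinearMap.sum_apply,
    ← Finset.Ico_add_one_right_eq_Icc, Finset.sum_Ico_eq_sum_range, Nat.add_sub_cancel]
  refine (Finset.sum_congr rfl fun n _ => ?_).trans
    (Finset.sum_subset (Finset.range_subset_range.2 hN) fun n _ hn => ?_)
  · rw [LinearMap.smul_apply, smul_eq_mul, add_comm 1 n, pow_add, pow_add]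
    push_cast
    ring
  · rw [LinearMap.smul_apply, convPowD_monomial_eq_zero hu (n + 1) d, smul_zero]
    simpa [Nat.lt_succ_iff] using hn

lemma convExpD_apply_one (s : Form σ) : convExpD s 1 = 1 := by
  rw [form_apply_one, convExpD, constr_basisMonomials_monomial]
  simp [convPowD, counitF_monomial, -monomial_zero']

lemma convLogD_apply_one (ρ : Form σ) : convLogD ρ 1 = 0 := by
  rw [form_apply_one, convLogD, constr_basisMonomials_monomial]
  simp

lemma cardDeriv_convExpTrunc_succ (s : Form σ) (N : ℕ) :
    cardDeriv σ (convExpTrunc s (N + 1)) = convD (convExpTrunc s N) (cardDeriv σ s) := by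
  induction N with
  | zero => simp [convExpTrunc, convPowD, cardDeriv_counitF, convD_zero_left]
  | succ N ih =>
    rw [convExpTrunc, Finset.sum_range_succ, ← convExpTrunc, map_add, ih, map_smul,
      cardDeriv_convPowD_succ, smul_smul]
    conv_rhs => rw [convExpTrunc, Finset.sum_range_succ, ← convExpTrunc]
    rw [convD_add_left, convD_smul_left]
    congr 2
    rw [Nat.factorial_succ]
    push_cast
    field_simp

lemma cardDeriv_convExpD {s : Form σ} (hs : s 1 = 0) :
    cardDeriv σ (convExpD s) = convD (convExpD s) (cardDeriv σ s) := by
  refine form_ext fun d => ?_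
  rw [cardDeriv_monomial,
    convExpD_monomial hs (Nat.lt_succ_of_lt (Nat.lt_succ_self d.support.card)),
    ← cardDeriv_monomial, cardDeriv_convExpTrunc_succ]
  exact convD_monomial_congr_left fun a ha =>
    (convExpD_monomial hs (Nat.lt_succ_of_le ha)).symm

lemma convD_cardDeriv_convLogTrunc (u : Form σ) (N : ℕ) :
    convD (counitF σ + u) (cardDeriv σ (convLogTrunc u N)) =
      cardDeriv σ u - (-1 : ℚ) ^ N • convD (convPowD u N) (cardDeriv σ u) := by
  induction N with
  | zero => simp [convLogTrunc, convPowD, counitF_convD, convD_zero_right]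
  | succ N ih =>
    have hN : (N : ℚ) + 1 ≠ 0 := by positivity
    rw [convLogTrunc, Finset.sum_range_succ, ← convLogTrunc, map_add, convD_add_right, ih,
      map_smul, cardDeriv_convPowD_succ, smul_smul, div_mul_cancel₀ _ hN, convD_smul_right,
      convD_add_left, counitF_convD, ← convD_assoc, convD_comm u, ← convPowD, pow_succ]
    module

lemma convD_cardDeriv_convLogD {ρ : Form σ} (hρ : ρ 1 = 1) :
    convD ρ (cardDeriv σ (convLogD ρ)) = cardDeriv σ ρ := by
  have hu := sub_counitF_apply_one hρ
  refine form_ext fun d => ?_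
  have hcongr := convD_monomial_congr_right (f := ρ) (g := cardDeriv σ (convLogD ρ))
    (g' := cardDeriv σ (convLogTrunc (ρ - counitF σ) (d.support.card + 1))) (d := d)
    fun a ha => by
      rw [cardDeriv_monomial, cardDeriv_monomial, convLogD_monomial hρ (ha.trans (Nat.le_succ _))]
  have hlog := convD_cardDeriv_convLogTrunc (ρ - counitF σ) (d.support.card + 1)
  have hzero := convD_monomial_congr_left (f := convPowD (ρ - counitF σ) (d.support.card + 1))
    (f' := 0) (g := cardDeriv σ (ρ - counitF σ)) (d := d)
    fun a ha => convPowD_monomial_eq_zero hu _ a (Nat.lt_succ_of_le ha)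
  rw [add_sub_cancel] at hlog
  rw [hcongr, hlog, LinearMap.sub_apply, LinearMap.smul_apply, hzero, convD_zero_left,
    LinearMap.zero_apply, smul_zero, sub_zero, map_sub, cardDeriv_counitF, sub_zero]

lemma convExpD_convLogD {ρ : Form σ} (hρ : ρ 1 = 1) : convExpD (convLogD ρ) = ρ := by
  refine sub_eq_zero.1 (eq_zero_of_cardDeriv_eq_convD (g := cardDeriv σ (convLogD ρ)) ?_
    (cardDeriv_apply_one _) ?_)
  · rw [LinearMap.sub_apply, convExpD_apply_one, hρ, sub_self]
  · rw [map_sub, cardDeriv_convExpD (convLogD_apply_one ρ), convD_sub_left,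
      convD_cardDeriv_convLogD hρ]

lemma convLogD_convExpD {s : Form σ} (hs : s 1 = 0) : convLogD (convExpD s) = s := by
  have hone := convExpD_apply_one s
  refine sub_eq_zero.1 (eq_zero_of_cardDeriv_eq_zero ?_ (eq_zero_of_convD_eq_zero hone ?_))
  · rw [LinearMap.sub_apply, convLogD_apply_one, hs, sub_zero]
  · rw [map_sub, convD_sub_right, convD_cardDeriv_convLogD hone, cardDeriv_convExpD hs,
      sub_self]

end LinkedCluster

/-- Linked cluster theorem for forms: δ-convolution exponential and logarithm
are mutually inverse.  For every unital form `ρ`, `e^{∗̂(log^{∗̂}ρ)} = ρ`, i.e.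
`ρ = e^{∗̂ρ_c}` for the connected form `ρ_c = log^{∗̂}ρ`; and for every
infinitesimal form `s`, `log^{∗̂}(e^{∗̂s}) = s`. -/
theorem stmt12 (σ : Type) :
    (∀ ρ : Form σ, ρ 1 = 1 → convExpD (convLogD ρ) = ρ) ∧
    (∀ s : Form σ, s 1 = 0 → convLogD (convExpD s) = s) := by
  exact ⟨fun _ hρ => convExpD_convLogD hρ, fun _ hs => convLogD_convExpD hs⟩

end
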